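/- Let d ≥ 1 and let v : ℝ × ℝ^d → ℝ^d be a continuously differentiable vector field which is divergence-free in its space variable, i.e. for every (t, x) the trace of the spatial derivative D_x v(t, x) vanishes. Suppose Φ : ℝ × ℝ^d → ℝ^d is continuously differentiable and satisfies Φ(0, x) = x and ∂_t Φ(t, x) = v(t, Φ(t, x)) for all (t, x), and that for each t the map Φ(t, ·) : ℝ^d → ℝ^d is a bijection. Then for each t the map Φ(t, ·) preserves d-dimensional Lebesgue measure: for every measurable set A ⊆ ℝ^d, the Lebesgue measure of Φ(t, ·)⁻¹(A) equals the Lebesgue measure of A. -/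

import Mathlib

open MeasureTheory

section ParametricDerivative

variable {E F : Type*} [NormedAddCommGroup E] [NormedSpace ℝ E]
  [NormedAddCommGroup F] [NormedSpace ℝ F]

/-- The partial derivative in the second variable of a differentiable function on `ℝ × E`. -/
theorem hasFDerivAt_snd_of_differentiable {w : ℝ → E → F}
    (hw : Differentiable ℝ (fun p : ℝ × E => w p.1 p.2)) (t : ℝ) (x : E) :
    HasFDerivAt (w t)
      ((fderiv ℝ (fun p : ℝ × E => w p.1 p.2) (t, x)).comp (ContinuousLinearMap.inr ℝ ℝ E)) x :=
  (hw (t, x)).hasFDerivAt.comp x (hasFDerivAt_prodMk_right t x)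

/-- The partial derivative in the second variable of a `C¹` function on `ℝ × E` is jointly
continuous. -/
theorem continuous_fderiv_snd_of_contDiff {w : ℝ → E → F}
    (hw : ContDiff ℝ 1 (fun p : ℝ × E => w p.1 p.2)) :
    Continuous (fun p : ℝ × E => fderiv ℝ (w p.1) p.2) := by
  have h : (fun p : ℝ × E => fderiv ℝ (w p.1) p.2) = fun p =>
      (fderiv ℝ (fun p : ℝ × E => w p.1 p.2) p).comp (ContinuousLinearMap.inr ℝ ℝ E) :=
    funext fun p =>
      (hasFDerivAt_snd_of_differentiable (hw.differentiable one_ne_zero) p.1 p.2).fderiv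
  rw [h]
  exact (hw.continuous_fderiv one_ne_zero).clm_comp continuous_const

/-- Differentiation under the integral sign for a `C¹` integrand on a finite-dimensional
parameter space. -/
theorem hasFDerivAt_intervalIntegral_of_contDiff [FiniteDimensional ℝ E] {w : ℝ → E → F}
    (hw : ContDiff ℝ 1 (fun p : ℝ × E => w p.1 p.2)) (a b : ℝ) (x : E) :
    HasFDerivAt (fun y => ∫ s in a..b, w s y) (∫ s in a..b, fderiv ℝ (w s) x) x := by
  have : ProperSpace E := FiniteDimensional.proper_real E
  have hD := continuous_fderiv_snd_of_contDiff hw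
  have hc (y : E) : Continuous fun s => w s y :=
    hw.continuous.comp (continuous_id.prodMk continuous_const)
  have hDc (y : E) : Continuous fun s => fderiv ℝ (w s) y :=
    hD.comp (continuous_id.prodMk continuous_const)
  obtain ⟨C, hC⟩ := (isCompact_uIcc.prod (isCompact_closedBall x 1)).exists_bound_of_continuousOn
    (s := Set.uIcc a b ×ˢ Metric.closedBall x 1) hD.continuousOn
  refine intervalIntegral.hasFDerivAt_integral_of_dominated_of_fderiv_le
    (F' := fun y s => fderiv ℝ (w s) y) (bound := fun _ => C)
    (Metric.closedBall_mem_nhds x one_pos)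
    (Filter.Eventually.of_forall fun y => (hc y).aestronglyMeasurable)
    ((hc x).intervalIntegrable a b) (hDc x).aestronglyMeasurable
    (Filter.Eventually.of_forall fun s hs y hy =>
      hC (s, y) ⟨Set.uIoc_subset_uIcc hs, hy⟩)
    intervalIntegrable_const
    (Filter.Eventually.of_forall fun s _ y _ => ?_)
  exact (hasFDerivAt_snd_of_differentiable
    (hw.differentiable one_ne_zero) s y).differentiableAt.hasFDerivAt

/-- If the time derivative of `Φ` is of class `C¹`, then time and space derivatives
of `Φ` commute. -/
theorem hasDerivAt_fderiv_of_hasDerivAt [FiniteDimensional ℝ E] [CompleteSpace F]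
    {Φ w : ℝ → E → F} (hΦ : Differentiable ℝ (Φ 0))
    (hw : ContDiff ℝ 1 (fun p : ℝ × E => w p.1 p.2))
    (h : ∀ t x, HasDerivAt (fun s => Φ s x) (w t x) t) (t : ℝ) (x : E) :
    HasDerivAt (fun s => fderiv ℝ (Φ s) x) (fderiv ℝ (w t) x) t := by
  have hc (y : E) : Continuous fun s => w s y :=
    hw.continuous.comp (continuous_id.prodMk continuous_const)
  have hDc : Continuous fun s => fderiv ℝ (w s) x :=
    (continuous_fderiv_snd_of_contDiff hw).comp (continuous_id.prodMk continuous_const)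
  have hint (s : ℝ) : Φ s = fun y => Φ 0 y + ∫ r in (0 : ℝ)..s, w r y := by
    ext y
    rw [intervalIntegral.integral_eq_sub_of_hasDerivAt (fun r _ => h r y)
      ((hc y).intervalIntegrable 0 s)]
    abel
  have hfd : (fun s => fderiv ℝ (Φ s) x) =
      fun s => fderiv ℝ (Φ 0) x + ∫ r in (0 : ℝ)..s, fderiv ℝ (w r) x := by
    ext1 s
    rw [hint s]
    exact ((hΦ x).hasFDerivAt.add (hasFDerivAt_intervalIntegral_of_contDiff hw 0 s x)).fderiv
  rw [hfd]
  exact (hDc.integral_hasStrictDerivAt 0 t).hasDerivAt.const_add _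

end ParametricDerivative

/-- **Liouville's formula** for matrices: if `M' = A * M` then `(det M)' = trace A * det M`. -/
theorem Matrix.hasDerivAt_det_of_hasDerivAt_mul {n : Type*} [Fintype n] [DecidableEq n]
    {M : ℝ → Matrix n n ℝ} {A : Matrix n n ℝ} {t : ℝ}
    (h : ∀ i j, HasDerivAt (fun s => M s i j) ((A * M t) i j) t) :
    HasDerivAt (fun s => (M s).det) (A.trace * (M t).det) t := by
  let f : ContinuousMultilinearMap ℝ (fun _ : n => n → ℝ) ℝ :=
    { (Matrix.detRowAlternating (R := ℝ) (n := n)).toMultilinearMap with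
      cont := Continuous.matrix_det continuous_id }
  have hrow (i : n) : HasFDerivAt (fun s => M s i)
      (ContinuousLinearMap.toSpanSingleton ℝ ((A * M t) i)) t :=
    (hasDerivAt_pi.2 fun j => h i j).hasFDerivAt
  have hdet := (HasFDerivAt.multilinear_comp f hrow).hasDerivAt
  refine hdet.congr_deriv ?_
  have hupd (i : n) : ((M t).updateRow i ((A * M t) i)).det = A i i * (M t).det := by
    have hsum : (A * M t) i = ∑ k, A i k • M t k := by
      ext j
      simp [Matrix.mul_apply]
    rw [hsum, Matrix.det_updateRow_sum, smul_eq_mul]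
  simp only [_root_.sum_apply, ContinuousLinearMap.comp_apply,
    ContinuousLinearMap.toSpanSingleton_apply, one_smul, Matrix.trace, Finset.sum_mul,
    Matrix.diag]
  exact Finset.sum_congr rfl fun i _ => hupd i

/-- **Liouville's formula**: if `L' = A ∘ L` then `(det L)' = trace A * det L`. -/
theorem ContinuousLinearMap.hasDerivAt_det_of_hasDerivAt_comp {E : Type*} [NormedAddCommGroup E]
    [NormedSpace ℝ E] [FiniteDimensional ℝ E] {L : ℝ → E →L[ℝ] E} {A : E →L[ℝ] E} {t : ℝ}
    (h : HasDerivAt L (A.comp (L t)) t) :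
    HasDerivAt (fun s => (L s).det) (LinearMap.trace ℝ E A * (L t).det) t := by
  let b := Module.finBasis ℝ E
  have hdet (s : ℝ) : (L s).det = (LinearMap.toMatrix b b (L s)).det :=
    (LinearMap.det_toMatrix b _).symm
  simp only [hdet, LinearMap.trace_eq_matrix_trace ℝ b]
  refine Matrix.hasDerivAt_det_of_hasDerivAt_mul fun i j => ?_
  rw [← LinearMap.toMatrix_comp]
  simp only [LinearMap.toMatrix_apply]
  exact (LinearMap.toContinuousLinearMap (b.coord i)).hasFDerivAt.comp_hasDerivAt t
    (h.clm_apply (hasDerivAt_const t (b j))) |>.congr_deriv (by simp)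

/-- The flow of a `C¹` divergence-free vector field on `ℝ^d` preserves the
`d`-dimensional Lebesgue measure. -/
theorem flow_of_divFree_measurePreserving
    (d : ℕ) (hd : 1 ≤ d)
    (v : ℝ → EuclideanSpace ℝ (Fin d) → EuclideanSpace ℝ (Fin d))
    (hv : ContDiff ℝ 1 (fun p : ℝ × EuclideanSpace ℝ (Fin d) => v p.1 p.2))
    (hdiv : ∀ (t : ℝ) (x : EuclideanSpace ℝ (Fin d)),
      LinearMap.trace ℝ (EuclideanSpace ℝ (Fin d))
        (fderiv ℝ (v t) x : EuclideanSpace ℝ (Fin d) →ₗ[ℝ] EuclideanSpace ℝ (Fin d)) = 0)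
    (Φ : ℝ → EuclideanSpace ℝ (Fin d) → EuclideanSpace ℝ (Fin d))
    (hΦreg : ContDiff ℝ 1 (fun p : ℝ × EuclideanSpace ℝ (Fin d) => Φ p.1 p.2))
    (hΦ0 : ∀ x, Φ 0 x = x)
    (hΦode : ∀ (t : ℝ) (x : EuclideanSpace ℝ (Fin d)),
      HasDerivAt (fun s => Φ s x) (v t (Φ t x)) t)
    (hΦbij : ∀ t : ℝ, Function.Bijective (Φ t)) :
    ∀ (t : ℝ) (A : Set (EuclideanSpace ℝ (Fin d))), MeasurableSet A →
      volume (Φ t ⁻¹' A) = volume A := by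
  have hΦd (t : ℝ) : Differentiable ℝ (Φ t) := fun x =>
    (hasFDerivAt_snd_of_differentiable (hΦreg.differentiable one_ne_zero) t x).differentiableAt
  have hvd (t : ℝ) : Differentiable ℝ (v t) := fun x =>
    (hasFDerivAt_snd_of_differentiable (hv.differentiable one_ne_zero) t x).differentiableAt
  have hderiv (t : ℝ) (x : EuclideanSpace ℝ (Fin d)) :
      HasDerivAt (fun s => (fderiv ℝ (Φ s) x).det) 0 t := by
    have hw : ContDiff ℝ 1
        (fun p : ℝ × EuclideanSpace ℝ (Fin d) => v p.1 (Φ p.1 p.2)) :=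
      hv.comp (contDiff_fst.prodMk hΦreg)
    have hJ := hasDerivAt_fderiv_of_hasDerivAt (w := fun t x => v t (Φ t x)) (hΦd 0) hw hΦode t x
    have hchain : fderiv ℝ (fun y => v t (Φ t y)) x =
        (fderiv ℝ (v t) (Φ t x)).comp (fderiv ℝ (Φ t) x) :=
      fderiv_comp x (hvd t (Φ t x)) (hΦd t x)
    rw [hchain] at hJ
    simpa [hdiv] using ContinuousLinearMap.hasDerivAt_det_of_hasDerivAt_comp hJ
  have hdet (t : ℝ) (x : EuclideanSpace ℝ (Fin d)) : (fderiv ℝ (Φ t) x).det = 1 := by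
    have hconst := is_const_of_deriv_eq_zero (fun s => (hderiv s x).differentiableAt)
      (fun s => (hderiv s x).deriv) t 0
    have hid : Φ 0 = id := funext hΦ0
    rw [hconst, hid, fderiv_id]
    exact LinearMap.det_id
  intro t A hA
  have hcov := lintegral_abs_det_fderiv_eq_addHaar_image volume
    ((hΦd t).continuous.measurable hA)
    (fun x _ => (hΦd t x).hasFDerivAt.hasFDerivWithinAt) (hΦbij t).injective.injOn
  rw [Set.image_preimage_eq A (hΦbij t).surjective] at hcov
  simpa [hdet] using hcov
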